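/- Assume G(x,y) = −(1/(2π)) ln|x−y| − h(x,y) with h : D × D → ℝ continuous and G symmetric. Let ω^λ ∈ K_λ be a maximizer of E over K_λ with profile ω_i^λ = sgn(κ_i)·λ·1_{Ω_i}, Ω_i = {x ∈ B_i : sgn(κ_i) ψ^λ(x) > μ_i^λ}, μ_i^λ > 0, i = 1,2, where ψ^λ(x) = ∫_D G(x,y) ω^λ(y) dy, and assume the energy lower bound E(ω^λ) ≥ −(1/(4π)) Σ_{i=1,2} κ_i² ln ε_i − C₁ and the vortex-core bound T(ω^λ) = (1/2) Σ_{i=1,2} ∫_D (ψ^λ − sgn(κ_i) μ_i^λ) ω_i^λ dx ≤ C₂, with C₁, C₂ independent of λ, where ε_i = √(|κ_i|/(λπ)). Then there exists C > 0 independent of λ such that |κ₁| μ₁^λ + |κ₂| μ₂^λ ≥ −(1/(2π))·(κ₁² ln ε₁ + κ₂² ln ε₂) − C. -/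

import Mathlib

open MeasureTheory Metric Set Filter Topology Real

noncomputable section

abbrev Pt : Type := EuclideanSpace ℝ (Fin 2)

def IsAdmissiblePair (D B1 B2 : Set Pt) (κ1 κ2 lam : ℝ) (ω1 ω2 : Pt → ℝ) : Prop :=
  Measurable ω1 ∧ Measurable ω2 ∧
  (∀ᵐ x ∂(volume.restrict D), 0 ≤ ω1 x ∧ ω1 x ≤ lam) ∧
  (∀ᵐ x ∂(volume.restrict D), -lam ≤ ω2 x ∧ ω2 x ≤ 0) ∧
  (∫ x in D, ω1 x) = κ1 ∧ (∫ x in D, ω2 x) = κ2 ∧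
  (∀ᵐ x ∂(volume.restrict D), x ∉ B1 → ω1 x = 0) ∧
  (∀ᵐ x ∂(volume.restrict D), x ∉ B2 → ω2 x = 0)

def InK (D B1 B2 : Set Pt) (κ1 κ2 lam : ℝ) (ω : Pt → ℝ) : Prop :=
  ∃ ω1 ω2 : Pt → ℝ, ω =ᵐ[volume.restrict D] ω1 + ω2 ∧
    IsAdmissiblePair D B1 B2 κ1 κ2 lam ω1 ω2

def energy (D : Set Pt) (G : Pt → Pt → ℝ) (ω : Pt → ℝ) : ℝ :=
  (1 / 2) * ∫ x in D, ∫ y in D, G x y * ω x * ω y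

theorem integrableOn_log_norm_closedBall (R : ℝ) :
    IntegrableOn (fun z : Pt => Real.log ‖z‖) (closedBall 0 R) := by
  have hradial : Integrable (fun z : Pt => (Iic R).indicator Real.log ‖z‖) := by
    rw [integrable_fun_norm_addHaar]
    have hrewrite : (fun y : ℝ => y ^ (Module.finrank ℝ Pt - 1) • (Iic R).indicator Real.log y)
        = (Iic R).indicator (fun y => y * Real.log y) := by
      funext y
      by_cases hy : y ∈ Iic R <;> simp [hy]
    rw [hrewrite, integrableOn_indicator_iff measurableSet_Iic]
    exact (Real.continuous_mul_log.integrableOn_Icc (a := 0) (b := R)).mono_set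
      fun y hy => ⟨hy.2.le, hy.1⟩
  rw [← integrable_indicator_iff measurableSet_closedBall]
  refine hradial.congr (Eventually.of_forall fun z => ?_)
  by_cases hz : ‖z‖ ≤ R <;> simp [hz]

theorem integrableOn_log_dist_prod {K : Set Pt} (hK : IsCompact K) :
    IntegrableOn (fun p : Pt × Pt => Real.log (dist p.1 p.2)) (K ×ˢ K) := by
  obtain ⟨R, hR⟩ := isBounded_iff.mp hK.isBounded
  have hone : Integrable (K.indicator (fun _ : Pt => (1 : ℝ))) :=
    (integrable_indicator_iff hK.measurableSet).mpr
      (integrableOn_const hK.measure_lt_top.ne)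
  have hlog := (integrable_indicator_iff measurableSet_closedBall).mpr
    (integrableOn_log_norm_closedBall R)
  have hconv := hone.convolution_integrand (ContinuousLinearMap.mul ℝ ℝ) hlog
  refine (hconv.integrableOn (s := K ×ˢ K)).congr_fun (fun p hp => ?_)
    (hK.measurableSet.prod hK.measurableSet)
  have hdist : p.1 - p.2 ∈ closedBall (0 : Pt) R := by
    simpa [dist_eq_norm] using hR hp.1 hp.2
  simp [indicator_of_mem hp.2, indicator_of_mem hdist, dist_eq_norm]

/-- The potential of a bounded density supported in `K`, weighted by another such density, is
integrable. -/
theorem integrableOn_potential_mul {D K : Set Pt} (hK : IsCompact K) {G : Pt → Pt → ℝ}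
    (hG : IntegrableOn (fun p : Pt × Pt => G p.1 p.2) (K ×ˢ K))
    {f g : Pt → ℝ} (hf : Measurable f) (hg : Measurable g) {a b : ℝ}
    (hfa : ∀ x, ‖f x‖ ≤ a) (hgb : ∀ x, ‖g x‖ ≤ b)
    (hfK : ∀ x, x ∉ K → f x = 0) (hgK : ∀ x, x ∉ K → g x = 0) :
    IntegrableOn (fun x => (∫ y in D, G x y * f y) * g x) D := by
  have hprod : Integrable (fun p : Pt × Pt => G p.1 p.2 * f p.2 * g p.1) := by
    have hmeas : Measurable fun p : Pt × Pt => f p.2 * g p.1 := by fun_prop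
    refine (((integrable_indicator_iff (hK.measurableSet.prod hK.measurableSet)).mpr hG).mul_bdd
      (c := a * b) hmeas.aestronglyMeasurable (Eventually.of_forall fun p => ?_)).congr
      (Eventually.of_forall fun p => ?_)
    · rw [norm_mul]
      exact mul_le_mul (hfa _) (hgb _) (norm_nonneg _) ((norm_nonneg _).trans (hfa p.2))
    · by_cases hp : p ∈ K ×ˢ K
      · simp only [indicator_of_mem hp]
        ring
      · rw [mem_prod, not_and_or] at hp
        rcases hp with hp | hp
        · simp [hgK _ hp]
        · simp [hfK _ hp]
  have hrestrict := hprod.integrableOn (s := D ×ˢ D)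
  rw [IntegrableOn, Measure.volume_eq_prod, ← Measure.prod_restrict] at hrestrict
  refine hrestrict.integral_prod_left.congr (Eventually.of_forall fun x => ?_)
  exact integral_mul_const (g x) fun y => G x y * f y

theorem two_mul_energy (D : Set Pt) (G : Pt → Pt → ℝ) (ω : Pt → ℝ) :
    2 * energy D G ω = ∫ x in D, (∫ y in D, G x y * ω y) * ω x := by
  rw [energy, ← mul_assoc]
  norm_num
  congr 1 with x
  rw [← integral_mul_const]
  congr 1 with y
  ring

theorem stmt9
    (D : Set Pt) (hDo : IsOpen D) (hDb : Bornology.IsBounded D)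
    (xb1 xb2 : Pt) (hx : xb1 ≠ xb2) (δ : ℝ) (hδ : 0 < δ)
    (hB1D : closedBall xb1 δ ⊆ D) (hB2D : closedBall xb2 δ ⊆ D)
    (hBdisj : Disjoint (closedBall xb1 δ) (closedBall xb2 δ))
    (κ1 κ2 : ℝ) (hκ1 : 0 < κ1) (hκ2 : κ2 < 0)
    (h : Pt → Pt → ℝ)
    (hh : ContinuousOn (fun p : Pt × Pt => h p.1 p.2) (D ×ˢ D))
    (G : Pt → Pt → ℝ)
    (hGdef : ∀ x ∈ D, ∀ y ∈ D, G x y = -(1 / (2 * π)) * Real.log (dist x y) - h x y)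
    (hGsym : ∀ x y, G x y = G y x)
    (lam1 : ℝ) (hlam1 : 0 < lam1)
    (μ1 μ2 : ℝ → ℝ) (ψ : ℝ → Pt → ℝ) (ω1 ω2 : ℝ → Pt → ℝ)
    (hω1 : ∀ lam : ℝ,
      ω1 lam = Set.indicator {x ∈ closedBall xb1 δ | μ1 lam < ψ lam x} (fun _ => lam))
    (hω2 : ∀ lam : ℝ,
      ω2 lam = Set.indicator {x ∈ closedBall xb2 δ | ψ lam x < -(μ2 lam)} (fun _ => -lam))
    (hψdef : ∀ lam : ℝ, lam1 ≤ lam → ∀ x,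
      ψ lam x = ∫ y in D, G x y * (ω1 lam y + ω2 lam y))
    (hadm : ∀ lam : ℝ, lam1 ≤ lam →
      IsAdmissiblePair D (closedBall xb1 δ) (closedBall xb2 δ) κ1 κ2 lam (ω1 lam) (ω2 lam))
    (hmax : ∀ lam : ℝ, lam1 ≤ lam →
      ∀ ω, InK D (closedBall xb1 δ) (closedBall xb2 δ) κ1 κ2 lam ω →
        energy D G ω ≤ energy D G (ω1 lam + ω2 lam))
    (hμpos : ∀ lam : ℝ, lam1 ≤ lam → 0 < μ1 lam ∧ 0 < μ2 lam)
    (C1 C2 : ℝ)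
    (hE : ∀ lam : ℝ, lam1 ≤ lam →
      -(1 / (4 * π)) * (κ1 ^ 2 * Real.log (Real.sqrt (κ1 / (lam * π)))
          + κ2 ^ 2 * Real.log (Real.sqrt (-κ2 / (lam * π)))) - C1 ≤
        energy D G (ω1 lam + ω2 lam))
    (hT : ∀ lam : ℝ, lam1 ≤ lam →
      (1 / 2) * ((∫ x in D, (ψ lam x - μ1 lam) * ω1 lam x) +
        (∫ x in D, (ψ lam x + μ2 lam) * ω2 lam x)) ≤ C2) :
    ∃ C > 0, ∀ lam : ℝ, lam1 ≤ lam →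
      -(1 / (2 * π)) * (κ1 ^ 2 * Real.log (Real.sqrt (κ1 / (lam * π)))
          + κ2 ^ 2 * Real.log (Real.sqrt (-κ2 / (lam * π)))) - C ≤
        κ1 * μ1 lam + (-κ2) * μ2 lam := by
  set K : Set Pt := closedBall xb1 δ ∪ closedBall xb2 δ
  have hK : IsCompact K := (isCompact_closedBall _ _).union (isCompact_closedBall _ _)
  have hKD : K ⊆ D := union_subset hB1D hB2D
  have hG : IntegrableOn (fun p : Pt × Pt => G p.1 p.2) (K ×ˢ K) := by
    have hreg : IntegrableOn (fun p : Pt × Pt => h p.1 p.2) (K ×ˢ K) :=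
      (hh.mono (prod_mono hKD hKD)).integrableOn_compact (hK.prod hK)
    exact IntegrableOn.congr_fun
      (((integrableOn_log_dist_prod hK).const_mul (-(1 / (2 * π)))).sub hreg)
      (fun p hp => (hGdef _ (hKD hp.1) _ (hKD hp.2)).symm)
      (hK.measurableSet.prod hK.measurableSet)
  refine ⟨max 1 (2 * C1 + 2 * C2), by positivity, fun lam hlam => ?_⟩
  obtain ⟨hm1, hm2, -, -, hint1, hint2, -, -⟩ := hadm lam hlam
  have hlam0 : 0 ≤ lam := hlam1.le.trans hlam
  have hbound1 : ∀ x, ‖ω1 lam x‖ ≤ lam := fun x => by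
    rw [hω1]
    exact (norm_indicator_le_norm_self _ _).trans (by simp [abs_of_nonneg hlam0])
  have hbound2 : ∀ x, ‖ω2 lam x‖ ≤ lam := fun x => by
    rw [hω2]
    exact (norm_indicator_le_norm_self _ _).trans (by simp [abs_of_nonneg hlam0])
  have hsupp1 : ∀ x, x ∉ K → ω1 lam x = 0 := fun x hx => by
    rw [hω1]
    exact indicator_of_notMem (fun hmem => hx (Or.inl hmem.1)) _
  have hsupp2 : ∀ x, x ∉ K → ω2 lam x = 0 := fun x hx => by
    rw [hω2]
    exact indicator_of_notMem (fun hmem => hx (Or.inr hmem.1)) _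
  have hpot : ∀ g : Pt → ℝ, Measurable g → (∀ x, ‖g x‖ ≤ lam) → (∀ x, x ∉ K → g x = 0) →
      IntegrableOn (fun x => ψ lam x * g x) D := fun g hg hgb hgK => by
    simp_rw [hψdef lam hlam]
    exact integrableOn_potential_mul hK hG (hm1.add hm2) hg
      (fun x => (norm_add_le _ _).trans (add_le_add (hbound1 x) (hbound2 x))) hgb
      (fun x hx => by simp [hsupp1 x hx, hsupp2 x hx]) hgK
  have hI1 := hpot _ hm1 hbound1 hsupp1
  have hI2 := hpot _ hm2 hbound2 hsupp2
  have hi1 : IntegrableOn (ω1 lam) D := .of_integral_ne_zero (by rw [hint1]; exact hκ1.ne')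
  have hi2 : IntegrableOn (ω2 lam) D := .of_integral_ne_zero (by rw [hint2]; exact hκ2.ne)
  have henergy : 2 * energy D G (ω1 lam + ω2 lam)
      = (∫ x in D, ψ lam x * ω1 lam x) + ∫ x in D, ψ lam x * ω2 lam x := by
    rw [two_mul_energy, ← integral_add hI1 hI2]
    simp only [hψdef lam hlam, Pi.add_apply, mul_add (∫ _ in D, _)]
  have hcore1 : (∫ x in D, (ψ lam x - μ1 lam) * ω1 lam x)
      = (∫ x in D, ψ lam x * ω1 lam x) - μ1 lam * κ1 := by
    rw [← hint1, ← integral_const_mul, ← integral_sub hI1 (hi1.const_mul _)]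
    simp only [sub_mul]
  have hcore2 : (∫ x in D, (ψ lam x + μ2 lam) * ω2 lam x)
      = (∫ x in D, ψ lam x * ω2 lam x) + μ2 lam * κ2 := by
    rw [← hint2, ← integral_const_mul, ← integral_add hI2 (hi2.const_mul _)]
    simp only [add_mul]
  have hTlam := hT lam hlam
  rw [hcore1, hcore2] at hTlam
  have hElam := hE lam hlam
  have hscale : 1 / (2 * π) = 2 * (1 / (4 * π)) := by
    field_simp
    norm_num
  rw [hscale]
  linarith [le_max_right 1 (2 * C1 + 2 * C2)]
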